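/- arXiv:1804.08101 — 2 statements merged into one kernel-verified Lean document; each statement's English description precedes it below -/
import Mathlib

section
/- For every real x > 1 and every real c > 0, the truncated vertical-line integral T ↦ (1/(2π)) · ∫_{-T}^{T} x^{c + i t} / (c + i t) dt tends to 1 as T → ∞, where x^{c+it} = exp((c+it)·ln x). -/
open MeasureTheory

lemma integral_inv_vertical_segment (r : ℝ) (hr : r ≠ 0) (T : ℝ) :
    ∫ t : ℝ in (-T)..T, 1 / ((r : ℂ) + Complex.I * (t : ℂ)) = 2 * (Real.arctan (T / r) : ℂ) := by
  have hpos (t : ℝ) : 0 < r ^ 2 + t ^ 2 := by positivity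
  have hne (t : ℝ) : (r : ℂ) + Complex.I * (t : ℂ) ≠ 0 := fun h => hr (by
    simpa using congrArg Complex.re h)
  have hderiv (t : ℝ) : HasDerivAt
      (fun t : ℝ => (Real.arctan (t / r) : ℂ) - Complex.I / 2 * (Real.log (r ^ 2 + t ^ 2) : ℂ))
      (1 / ((r : ℂ) + Complex.I * (t : ℂ))) t := by
    have h1 : HasDerivAt (fun t : ℝ => Real.arctan (t / r)) (1 / (1 + (t / r) ^ 2) * (1 / r)) t :=
      ((hasDerivAt_id t).div_const r).arctan
    have h2 : HasDerivAt (fun t : ℝ => Real.log (r ^ 2 + t ^ 2)) (2 * t / (r ^ 2 + t ^ 2)) t := by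
      have := (((hasDerivAt_id t).pow 2).const_add (r ^ 2)).log (hpos t).ne'
      simpa using this
    refine (h1.ofReal_comp.sub (h2.ofReal_comp.const_mul (Complex.I / 2))).congr_deriv ?_
    have h3 : ((r : ℂ) ^ 2 + (t : ℂ) ^ 2) ≠ 0 := by exact_mod_cast (hpos t).ne'
    have h4 : (r : ℂ) ≠ 0 := by exact_mod_cast hr
    have h5 : 1 / (1 + (t / r) ^ 2) * (1 / r) = r / (r ^ 2 + t ^ 2) := by
      have := (hpos t).ne'
      field_simp
    rw [h5]
    push_cast
    symm
    rw [div_eq_iff (hne t)]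
    field_simp
    linear_combination (t : ℂ) ^ 2 * Complex.I_sq
  rw [intervalIntegral.integral_eq_sub_of_hasDerivAt (fun t _ => hderiv t)]
  · simp only [neg_div, Real.arctan_neg, neg_sq]
    push_cast
    ring
  · apply Continuous.intervalIntegrable
    exact continuous_const.div (by fun_prop) hne

lemma norm_perron_integral_sub_arctan_le (x : ℝ) (hx : 1 < x) (c : ℝ) (hc : 0 < c) (a : ℝ)
    (ha : 0 < a) (T : ℝ) (hT : 0 < T) :
    ‖(∫ t : ℝ in (-T)..T,
        (x : ℂ) ^ ((c : ℂ) + Complex.I * (t : ℂ)) / ((c : ℂ) + Complex.I * (t : ℂ))) -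
        (2 * (Real.arctan (T / c) : ℂ) + 2 * (Real.arctan (T / a) : ℂ))‖ ≤
      2 * ((x ^ c + 1) / T * (c + a)) + x ^ (-a) / a * (2 * T) := by
  have hx0 : 0 < x := by linarith
  have hxc : (x : ℂ) ≠ 0 := by exact_mod_cast hx0.ne'
  set f : ℂ → ℂ := fun s => (x : ℂ) ^ s with hf
  have hfd : Differentiable ℂ f := fun s =>
    (differentiableAt_id).const_cpow (Or.inl hxc)
  set h : ℂ → ℂ := dslope f 0 with hh
  have hhd : Differentiable ℂ h := by
    rw [← differentiableOn_univ] at hfd ⊢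
    exact (Complex.differentiableOn_dslope Filter.univ_mem).2 hfd
  have h_eq (s : ℂ) (hs : s ≠ 0) : h s = (x : ℂ) ^ s / s - 1 / s := by
    rw [hh, dslope_of_ne _ hs, slope_def_field]
    simp [hf, sub_div]
  have hvert (r : ℝ) (hr : r ≠ 0) : ∫ t : ℝ in (-T)..T, h (r + t * Complex.I) =
      (∫ t : ℝ in (-T)..T,
        (x : ℂ) ^ ((r : ℂ) + Complex.I * (t : ℂ)) / ((r : ℂ) + Complex.I * (t : ℂ))) -
        2 * (Real.arctan (T / r) : ℂ) := by
    have hne (t : ℝ) : (r : ℂ) + Complex.I * (t : ℂ) ≠ 0 := fun h => hr (by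
      simpa using congrArg Complex.re h)
    rw [← integral_inv_vertical_segment r hr, ← intervalIntegral.integral_sub]
    · refine intervalIntegral.integral_congr fun t _ => ?_
      rw [← h_eq _ (hne t), mul_comm]
    · apply Continuous.intervalIntegrable
      exact (hfd.continuous.comp (by fun_prop)).div (by fun_prop) hne
    · apply Continuous.intervalIntegrable
      exact continuous_const.div (by fun_prop) hne
  have hhor (b : ℝ) (hb : |b| = T) :
      ‖∫ s : ℝ in (-a)..c, h (s + b * Complex.I)‖ ≤ (x ^ c + 1) / T * (c + a) := by
    have := intervalIntegral.norm_integral_le_of_norm_le_const (a := -a) (b := c)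
      (f := fun s : ℝ => h (s + b * Complex.I)) (C := (x ^ c + 1) / T) ?_
    · rwa [sub_neg_eq_add, abs_of_pos (by positivity)] at this
    intro s hs
    rw [Set.uIoc_of_le (by linarith)] at hs
    have hTn : T ≤ ‖(s : ℂ) + b * Complex.I‖ := by
      simpa [hb] using Complex.abs_im_le_norm ((s : ℂ) + b * Complex.I)
    have hne : (s : ℂ) + b * Complex.I ≠ 0 := norm_pos_iff.1 (hT.trans_le hTn)
    rw [h_eq _ hne, ← sub_div, norm_div]
    gcongr
    refine (norm_sub_le _ _).trans ?_
    rw [Complex.norm_cpow_eq_rpow_re_of_pos hx0, norm_one]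
    gcongr
    · exact hx.le
    · simpa using hs.2
  have hleft : ‖∫ t : ℝ in (-T)..T, (x : ℂ) ^ (((-a : ℝ) : ℂ) + Complex.I * (t : ℂ)) /
      (((-a : ℝ) : ℂ) + Complex.I * (t : ℂ))‖ ≤ x ^ (-a) / a * (2 * T) := by
    have := intervalIntegral.norm_integral_le_of_norm_le_const (a := -T) (b := T)
      (f := fun t : ℝ => (x : ℂ) ^ (((-a : ℝ) : ℂ) + Complex.I * (t : ℂ)) /
        (((-a : ℝ) : ℂ) + Complex.I * (t : ℂ))) (C := x ^ (-a) / a) ?_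
    · rwa [sub_neg_eq_add, ← two_mul, abs_of_pos (by positivity)] at this
    intro t _
    rw [norm_div, Complex.norm_cpow_eq_rpow_re_of_pos hx0]
    have hn : a ≤ ‖((-a : ℝ) : ℂ) + Complex.I * (t : ℂ)‖ := by
      simpa [abs_of_pos ha] using Complex.abs_re_le_norm (((-a : ℝ) : ℂ) + Complex.I * (t : ℂ))
    have hre : (((-a : ℝ) : ℂ) + Complex.I * (t : ℂ)).re = -a := by simp
    rw [hre]
    gcongr
  have hrect := Complex.integral_boundary_rect_eq_zero_of_differentiableOn h
    (⟨-a, -T⟩ : ℂ) ⟨c, T⟩ hhd.differentiableOn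
  simp only [smul_eq_mul] at hrect
  rw [hvert c hc.ne', hvert (-a) (neg_ne_zero.2 ha.ne'), div_neg, Real.arctan_neg] at hrect
  set A := ∫ s : ℝ in (-a)..c, h (s + ((-T : ℝ) : ℂ) * Complex.I)
  set B := ∫ s : ℝ in (-a)..c, h (s + (T : ℂ) * Complex.I)
  set L := ∫ t : ℝ in (-T)..T, (x : ℂ) ^ (((-a : ℝ) : ℂ) + Complex.I * (t : ℂ)) /
      (((-a : ℝ) : ℂ) + Complex.I * (t : ℂ))
  set R := ∫ t : ℝ in (-T)..T,
    (x : ℂ) ^ ((c : ℂ) + Complex.I * (t : ℂ)) / ((c : ℂ) + Complex.I * (t : ℂ))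
  have hA : ‖A‖ ≤ (x ^ c + 1) / T * (c + a) := hhor _ (by rw [abs_neg, abs_of_pos hT])
  have hB : ‖B‖ ≤ (x ^ c + 1) / T * (c + a) := hhor _ (abs_of_pos hT)
  have key : R - (2 * (Real.arctan (T / c) : ℂ) + 2 * (Real.arctan (T / a) : ℂ)) =
      Complex.I * (A - B) + L := by
    rw [Complex.ofReal_neg] at hrect
    linear_combination (-Complex.I) * hrect +
      (R - 2 * (Real.arctan (T / c) : ℂ) - L - 2 * (Real.arctan (T / a) : ℂ)) * Complex.I_sq
  rw [key]
  refine (norm_add_le _ _).trans (add_le_add ?_ hleft)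
  rw [norm_mul, Complex.norm_I, one_mul]
  linarith [norm_sub_le A B]

/-- Perron-type discontinuous integral: for `x > 1` and `c > 0`,
`(1/(2π)) ∫_{-T}^{T} x^{c+it}/(c+it) dt → 1` as `T → ∞`. -/
theorem stmt3 (x : ℝ) (hx : 1 < x) (c : ℝ) (hc : 0 < c) :
    Filter.Tendsto
      (fun T : ℝ => (1 / (2 * (Real.pi : ℂ))) *
        ∫ t : ℝ in (-T)..T,
          (x : ℂ) ^ ((c : ℂ) + Complex.I * (t : ℂ)) / ((c : ℂ) + Complex.I * (t : ℂ)))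
      Filter.atTop (nhds 1) := by
  have hx0 : 0 < x := by linarith
  have hsqrt := Real.tendsto_sqrt_atTop
  have harctan : Filter.Tendsto Real.arctan Filter.atTop (nhds (Real.pi / 2)) :=
    Real.tendsto_arctan_atTop.mono_right nhdsWithin_le_nhds
  have hbound : Filter.Tendsto (fun T : ℝ =>
      2 * ((x ^ c + 1) / T * (c + √T)) + x ^ (-√T) / √T * (2 * T))
      Filter.atTop (nhds 0) := by
    have h1 : Filter.Tendsto (fun u : ℝ => 2 * (x ^ c + 1) * (c * (u⁻¹ * u⁻¹) + u⁻¹) +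
        2 * (u ^ (1 : ℝ) * Real.exp (-Real.log x * u))) Filter.atTop (nhds 0) := by
      have hi := tendsto_inv_atTop_zero (𝕜 := ℝ)
      have he := tendsto_rpow_mul_exp_neg_mul_atTop_nhds_zero 1 (Real.log x) (Real.log_pos hx)
      simpa using ((((hi.mul hi).const_mul c).add hi).const_mul (2 * (x ^ c + 1))).add
        (he.const_mul 2)
    refine (h1.comp hsqrt).congr' ?_
    filter_upwards [Filter.eventually_gt_atTop 0] with T hT
    have hs : 0 < √T := Real.sqrt_pos.2 hT
    have hT2 : T = √T * √T := (Real.mul_self_sqrt hT.le).symm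
    simp only [Function.comp_apply, Real.rpow_one]
    rw [Real.rpow_def_of_pos hx0 (-√T), mul_neg, neg_mul]
    generalize √T = u at *
    subst hT2
    field_simp
  have hmain : Filter.Tendsto (fun T : ℝ =>
      2 * (Real.arctan (T / c) : ℂ) + 2 * (Real.arctan (T / √T) : ℂ))
      Filter.atTop (nhds (2 * (Real.pi : ℂ))) := by
    have h1 : Filter.Tendsto (fun T : ℝ => 2 * Real.arctan (T / c) + 2 * Real.arctan (T / √T))
        Filter.atTop (nhds (2 * Real.pi)) := by
      simp only [Real.div_sqrt]
      rw [show 2 * Real.pi = 2 * (Real.pi / 2) + 2 * (Real.pi / 2) by ring]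
      exact ((harctan.comp (Filter.tendsto_id.atTop_div_const hc)).const_mul 2).add
        ((harctan.comp hsqrt).const_mul 2)
    exact_mod_cast (Complex.continuous_ofReal.tendsto _).comp h1
  have hdiff := squeeze_zero_norm' (f := fun T : ℝ => (∫ t : ℝ in (-T)..T,
      (x : ℂ) ^ ((c : ℂ) + Complex.I * (t : ℂ)) / ((c : ℂ) + Complex.I * (t : ℂ))) -
      (2 * (Real.arctan (T / c) : ℂ) + 2 * (Real.arctan (T / √T) : ℂ))) ?_ hbound
  · have hpi : (Real.pi : ℂ) ≠ 0 := by exact_mod_cast Real.pi_ne_zero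
    have := (hdiff.add hmain).const_mul (1 / (2 * (Real.pi : ℂ)))
    simp only [sub_add_cancel, zero_add] at this
    rwa [one_div_mul_cancel (mul_ne_zero two_ne_zero hpi)] at this
  · filter_upwards [Filter.eventually_gt_atTop 0] with T hT
    exact norm_perron_integral_sub_arctan_le x hx c hc _ (Real.sqrt_pos.2 hT) T hT
end

section
/- Fix an integer M ≥ 1 and real numbers α > 0 and λ_T > 0. Then the function f(z_1, …, z_M) = (2π λ_T / α)^M · exp(-π λ_T z_M^{2/α}) · ∏_{m=1}^{M} z_m^{2/α - 1} is a probability density on the ordered region 0 ≤ z_1 ≤ z_2 ≤ ⋯ ≤ z_M < ∞; that is, the iterated integral ∫_0^{∞} ∫_0^{z_M} ⋯ ∫_0^{z_2} f(z_1, …, z_M) dz_1 ⋯ dz_{M-1} dz_M equals 1. -/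
open MeasureTheory

/-- Iterated integral over the ordered region `0 ≤ z_1 ≤ ⋯ ≤ z_n ≤ Z`:
the outermost variable `z_n` (the last coordinate) ranges over `(0, Z]`, and each inner
variable ranges from `0` up to the next variable. -/
noncomputable def orderedIterIntR : (n : ℕ) → ((Fin n → ℝ) → ℝ) → ℝ → ℝ
  | 0, g, _ => g (fun i => i.elim0)
  | n + 1, g, Z => ∫ z in Set.Ioc (0 : ℝ) Z, orderedIterIntR n (fun v => g (Fin.snoc v z)) z

/-- The ordered iterated integral of `c * ∏ v_i ^ (p - 1)` up to `Z`. -/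
theorem orderedIterIntR_const_mul_prod_rpow {p : ℝ} (hp : 0 < p) (n : ℕ) (c : ℝ) {Z : ℝ}
    (hZ : 0 < Z) :
    orderedIterIntR n (fun v => c * ∏ i, v i ^ (p - 1)) Z
      = c / (n.factorial * p ^ n) * Z ^ (p * n) := by
  induction n generalizing c Z with
  | zero => simp [orderedIterIntR]
  | succ n ih =>
    have hpn : 0 < p * (n + 1) := by positivity
    have key : ∀ z ∈ Set.Ioc (0 : ℝ) Z,
        orderedIterIntR n (fun v => c * ∏ i, (Fin.snoc v z : Fin (n + 1) → ℝ) i ^ (p - 1)) z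
          = c / (n.factorial * p ^ n) * z ^ (p * (n + 1) - 1) := by
      intro z hz
      have hfun : (fun v : Fin n → ℝ =>
          c * ∏ i, (Fin.snoc v z : Fin (n + 1) → ℝ) i ^ (p - 1))
          = fun v => (c * z ^ (p - 1)) * ∏ i, v i ^ (p - 1) := by
        funext v
        simp only [Fin.prod_univ_castSucc, Fin.snoc_castSucc, Fin.snoc_last]
        ring
      rw [hfun, ih _ hz.1, show p * ((n : ℝ) + 1) - 1 = (p - 1) + p * n by ring,
        Real.rpow_add hz.1]
      ring
    rw [orderedIterIntR, setIntegral_congr_fun measurableSet_Ioc key, integral_const_mul,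
      ← intervalIntegral.integral_of_le hZ.le, integral_rpow (Or.inl (by linarith)),
      sub_add_cancel, Real.zero_rpow hpn.ne', Nat.factorial_succ]
    push_cast
    field_simp
    ring

/-- The function `f(z_1,…,z_M) = (2πλ_T/α)^M exp(-πλ_T z_M^{2/α}) ∏_m z_m^{2/α-1}`
(the joint density of Corollary 1, with `M = n + 1 ≥ 1`, `α > 0`, `λ_T > 0`) integrates
to `1` over the ordered region `0 ≤ z_1 ≤ ⋯ ≤ z_M < ∞`. -/
theorem stmt8 (n : ℕ) (α lamT : ℝ) (hα : 0 < α) (hlam : 0 < lamT) :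
    (∫ z in Set.Ioi (0 : ℝ),
        orderedIterIntR n
          (fun v =>
            (fun w : Fin (n + 1) → ℝ =>
                (2 * Real.pi * lamT / α) ^ (n + 1) *
                  Real.exp (-(Real.pi * lamT * (w (Fin.last n)) ^ (2 / α))) *
                  ∏ m : Fin (n + 1), (w m) ^ (2 / α - 1))
              (Fin.snoc v z)) z) = 1 := by
  have hp : 0 < 2 / α := by positivity
  have hC : 2 * Real.pi * lamT / α = 2 / α * (Real.pi * lamT) := by ring
  have hb : 0 < Real.pi * lamT := by positivity
  rw [hC]
  generalize 2 / α = p at hp ⊢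
  generalize Real.pi * lamT = b at hb ⊢
  have key : ∀ z ∈ Set.Ioi (0 : ℝ),
      orderedIterIntR n
          (fun v =>
            (fun w : Fin (n + 1) → ℝ =>
                (p * b) ^ (n + 1) * Real.exp (-(b * (w (Fin.last n)) ^ p)) *
                  ∏ m : Fin (n + 1), (w m) ^ (p - 1))
              (Fin.snoc v z)) z
        = (p * b) ^ (n + 1) / (n.factorial * p ^ n) *
            (z ^ (p * (n + 1) - 1) * Real.exp (-b * z ^ p)) := by
    intro z hz
    have hfun : (fun v : Fin n → ℝ =>
            (fun w : Fin (n + 1) → ℝ =>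
                (p * b) ^ (n + 1) * Real.exp (-(b * (w (Fin.last n)) ^ p)) *
                  ∏ m : Fin (n + 1), (w m) ^ (p - 1))
              (Fin.snoc v z))
        = fun v => ((p * b) ^ (n + 1) * Real.exp (-(b * z ^ p)) * z ^ (p - 1)) *
            ∏ i, v i ^ (p - 1) := by
      funext v
      simp only [Fin.prod_univ_castSucc, Fin.snoc_castSucc, Fin.snoc_last]
      ring
    rw [hfun, orderedIterIntR_const_mul_prod_rpow hp n _ hz,
      show p * ((n : ℝ) + 1) - 1 = (p - 1) + p * n by ring, Real.rpow_add hz, neg_mul]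
    ring
  have hpn : 0 < p * ((n : ℝ) + 1) := by positivity
  rw [setIntegral_congr_fun measurableSet_Ioi key, integral_const_mul,
    integral_rpow_mul_exp_neg_mul_rpow hp (by linarith) hb, neg_div, sub_add_cancel,
    mul_div_cancel_left₀ _ hp.ne', Real.Gamma_nat_eq_factorial, Real.rpow_neg hb.le]
  norm_cast
  have := n.factorial_ne_zero
  field_simp
  ring
end
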